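/- The Zeeman topology Z on Minkowski space M = ℝ⁴ induces the 1-dimensional Euclidean topology on every time axis; that is, for every time axis A = {x + t • v : t ∈ ℝ} with Q(v) > 0, the subspace topology that Z induces on A coincides with the subspace topology that the Euclidean topology induces on A. -/

import Mathlib

noncomputable section

/-- Minkowski space: `ℝ⁴` with the Euclidean (norm) topology as its
standard topology. -/
abbrev M4 : Type := EuclideanSpace ℝ (Fin 4)

/-- The Minkowski quadratic form `Q(x) = x₀² − x₁² − x₂² − x₃²`. -/
def Q (x : M4) : ℝ := x 0 ^ 2 - x 1 ^ 2 - x 2 ^ 2 - x 3 ^ 2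

/-- The light cone of a point `x`. -/
def lightCone (x : M4) : Set M4 := {y : M4 | y ≠ x ∧ Q (y - x) = 0}

/-- The basic Zeeman neighbourhood `(B_E(x,r) \ N(x)) ∪ {x}`. -/
def zeemanBall (x : M4) (r : ℝ) : Set M4 :=
  (Metric.ball x r \ lightCone x) ∪ {x}

/-- The Zeeman topology `Z`, generated by the sets `(B_E(x,r) \ N(x)) ∪ {x}`. -/
def Ztop : TopologicalSpace M4 :=
  TopologicalSpace.generateFrom {s : Set M4 | ∃ x : M4, ∃ r : ℝ, 0 < r ∧ s = zeemanBall x r}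

theorem continuous_Q : Continuous Q := by
  unfold Q
  fun_prop

theorem Q_smul (t : ℝ) (v : M4) : Q (t • v) = t ^ 2 * Q v := by
  simp only [Q, PiLp.smul_apply, smul_eq_mul]
  ring

/-- The Zeeman topology is finer than the Euclidean topology. -/
theorem Ztop_le_euclidean : Ztop ≤ (inferInstance : TopologicalSpace M4) := by
  intro U hU
  refine (@isOpen_iff_forall_mem_open M4 Ztop U).2 fun y hy => ?_
  obtain ⟨r, hr, hball⟩ := Metric.isOpen_iff.1 hU y hy
  refine ⟨zeemanBall y r, ?_, TopologicalSpace.isOpen_generateFrom_of_mem ⟨y, r, hr, rfl⟩,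
    Or.inr rfl⟩
  rintro z (hz | rfl)
  · exact hball hz.1
  · exact hy

/-- A Zeeman ball centred at a point of a set without lightlike separated pairs meets that set
in a Euclidean ball. -/
theorem mem_zeemanBall_iff_of_Q_ne_zero {p q : M4} {r : ℝ} (hr : 0 < r)
    (h : q ≠ p → Q (q - p) ≠ 0) : q ∈ zeemanBall p r ↔ q ∈ Metric.ball p r := by
  constructor
  · rintro (hq | rfl)
    · exact hq.1
    · exact Metric.mem_ball_self hr
  · exact fun hq => Or.inl ⟨hq, fun hN => h hN.1 hN.2⟩

/-- Away from its centre, a Zeeman ball is the Euclidean ball minus the zeros of the form. -/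
theorem mem_zeemanBall_iff_of_ne {p q : M4} {r : ℝ} (h : q ≠ p) :
    q ∈ zeemanBall p r ↔ q ∈ Metric.ball p r ∩ {y | Q (y - p) ≠ 0} := by
  simp [zeemanBall, lightCone, h]

/-- On every time axis `A = {x + t • v : t ∈ ℝ}` (with `Q v > 0`), the
Zeeman topology `Z` induces the same subspace topology as the Euclidean
topology, namely the 1-dimensional Euclidean topology of the line. -/
theorem zeeman_induces_euclidean_on_time_axes :
    ∀ x v : M4, 0 < Q v →
      TopologicalSpace.induced
          (Subtype.val : {p : M4 | ∃ t : ℝ, p = x + t • v} → M4) Ztop =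
      TopologicalSpace.induced
          (Subtype.val : {p : M4 | ∃ t : ℝ, p = x + t • v} → M4)
          inferInstance := by
  intro x v hv
  refine le_antisymm (induced_mono Ztop_le_euclidean) ?_
  rw [Ztop, induced_generateFrom_eq]
  refine le_generateFrom ?_
  rintro _ ⟨_, ⟨p, r, hr, rfl⟩, rfl⟩
  by_cases hp : ∃ t : ℝ, p = x + t • v
  · refine ⟨Metric.ball p r, Metric.isOpen_ball, ?_⟩
    ext ⟨q, hq⟩
    refine (mem_zeemanBall_iff_of_Q_ne_zero hr ?_).symm
    obtain ⟨s, rfl⟩ := hp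
    obtain ⟨t, rfl⟩ := hq
    intro hne
    rw [add_sub_add_left_eq_sub, ← sub_smul, Q_smul]
    have hts : t - s ≠ 0 := fun h => hne (by rw [sub_eq_zero.1 h])
    positivity
  · refine ⟨Metric.ball p r ∩ {y | Q (y - p) ≠ 0}, Metric.isOpen_ball.inter ?_, ?_⟩
    · exact isOpen_ne_fun (continuous_Q.comp (continuous_id.sub continuous_const))
        continuous_const
    · ext ⟨q, hq⟩
      refine (mem_zeemanBall_iff_of_ne ?_).symm
      rintro rfl
      exact hp hq
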